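/- arXiv:2404.08072 — 2 statements merged into one kernel-verified Lean document; each statement's English description precedes it below -/
import Mathlib

section
/- Let A be a finite alphabet, π a permutation of A of order n, and v a word over A ∪ Ā. Then (ψ_v ∘ π)ⁿ = ψ_{v · π(v) · π²(v) ⋯ πⁿ⁻¹(v)}, where πʲ(v) denotes the letterwise action of πʲ on v. In particular, every episturmian morphism has a power of the form ψ_w for some word w over A ∪ Ā. -/
open List

section EpiDefs

variable {A : Type*}

/-- The episturmian generator ψ_a : a ↦ a, b ↦ ab for b ≠ a, as a map on words. -/
def psiL [DecidableEq A] (a : A) : List A → List A :=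
  fun u => (u.map (fun b => if b = a then [a] else [a, b])).flatten

/-- The episturmian generator ψ̄_a : a ↦ a, b ↦ ba for b ≠ a, as a map on words. -/
def psibarL [DecidableEq A] (a : A) : List A → List A :=
  fun u => (u.map (fun b => if b = a then [a] else [b, a])).flatten

/-- ψ_{u₁⋯uₙ} = ψ_{u₁} ∘ ⋯ ∘ ψ_{uₙ}. -/
def psiW [DecidableEq A] (u : List A) : List A → List A :=
  u.foldr (fun a f => psiL a ∘ f) id

/-- ψ̄_{u₁⋯uₙ} = ψ̄_{u₁} ∘ ⋯ ∘ ψ̄_{uₙ}. -/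
def psibarW [DecidableEq A] (u : List A) : List A → List A :=
  u.foldr (fun a f => psibarL a ∘ f) id

/-- There is a shortest palindrome having `x` as a prefix. -/
theorem exists_isPalClosure (x : List A) :
    ∃ p : List A, (p.reverse = p ∧ x <+: p) ∧
      ∀ q : List A, q.reverse = q → x <+: q → p.length ≤ q.length := by
  classical
  have hex : ∃ n : ℕ, ∃ p : List A, (p.reverse = p ∧ x <+: p) ∧ p.length = n :=
    ⟨(x ++ x.reverse).length, x ++ x.reverse, ⟨by simp, ⟨x.reverse, rfl⟩⟩, rfl⟩
  obtain ⟨p, hp, hlen⟩ := Nat.find_spec hex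
  refine ⟨p, hp, fun q h1 h2 => ?_⟩
  rw [hlen]
  exact Nat.find_le ⟨q, ⟨h1, h2⟩, rfl⟩

/-- `palPlus x = x⁽⁺⁾` is the shortest palindrome having `x` as a prefix. -/
noncomputable def palPlus (x : List A) : List A :=
  Classical.choose (exists_isPalClosure x)

/-- Iterated palindromic closure: Pal(ε) = ε, Pal(ua) = (Pal(u)a)⁽⁺⁾. -/
noncomputable def pal (u : List A) : List A :=
  u.foldl (fun p a => palPlus (p ++ [a])) []

/-- Longest common prefix. -/
def gcp [DecidableEq A] : List A → List A → List A
  | a :: x, b :: y => if a = b then a :: gcp x y else []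
  | _, _ => []

/-- Longest common suffix. -/
def gcs [DecidableEq A] (x y : List A) : List A :=
  (gcp x.reverse y.reverse).reverse

/-- The language of a (primitive) substitution: factors of σⁿ(a). -/
def LangS (σ : List A → List A) : Set (List A) :=
  {x | ∃ (n : ℕ) (a : A), x <:+: σ^[n] [a]}

/-- The language of the episturmian shift directed by `d`. -/
def LangD (d : ℕ → A) : Set (List A) :=
  {x | ∃ n : ℕ, x <:+: pal ((List.range n).map d)}

def LeftSpecial (L : Set (List A)) (v : List A) : Prop :=
  ∃ a b : A, a ≠ b ∧ a :: v ∈ L ∧ b :: v ∈ L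

def RightSpecial (L : Set (List A)) (v : List A) : Prop :=
  ∃ a b : A, a ≠ b ∧ v ++ [a] ∈ L ∧ v ++ [b] ∈ L

/-- The left return set of `u` in the language `L`. -/
def leftReturn (L : Set (List A)) (u : List A) : Set (List A) :=
  {r | r ++ u ∈ L ∧ (∃ s : List A, s ≠ [] ∧ r ++ u = u ++ s) ∧
    ¬∃ p q : List A, p ≠ [] ∧ q ≠ [] ∧ r ++ u = p ++ u ++ q}

/-- The right return set of `u` in the language `L`. -/
def rightReturn (L : Set (List A)) (u : List A) : Set (List A) :=
  {r | u ++ r ∈ L ∧ (∃ p : List A, p ≠ [] ∧ u ++ r = p ++ u) ∧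
    ¬∃ p q : List A, p ≠ [] ∧ q ≠ [] ∧ u ++ r = p ++ u ++ q}

/-- `σ` is an endomorphism of the free monoid A*. -/
def IsListHom (σ : List A → List A) : Prop :=
  ∀ x y : List A, σ (x ++ y) = σ x ++ σ y

/-- Primitivity of a substitution. -/
def IsPrimitiveSubst (σ : List A → List A) : Prop :=
  ∃ k : ℕ, 1 ≤ k ∧ ∀ a b : A, b ∈ σ^[k] [a]

/-- At least two distinct letters occur infinitely often in `d`. -/
def NonDegenerate (d : ℕ → A) : Prop :=
  ∃ a b : A, a ≠ b ∧ (∀ N : ℕ, ∃ n : ℕ, N ≤ n ∧ d n = a) ∧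
    (∀ N : ℕ, ∃ n : ℕ, N ≤ n ∧ d n = b)

end EpiDefs

/-- Generators indexed by A ⊕ A: unbarred letters give ψ_a, barred letters give ψ̄_a. -/
def psiE {A : Type*} [DecidableEq A] : A ⊕ A → (List A → List A)
  | Sum.inl a => psiL a
  | Sum.inr a => psibarL a

/-- ψ_v for a word v over A ∪ Ā. -/
def psiEW {A : Type*} [DecidableEq A] (v : List (A ⊕ A)) : List A → List A :=
  v.foldr (fun c f => psiE c ∘ f) id

theorem psiE_map_perm {A : Type*} [DecidableEq A] (σ : Equiv.Perm A) (c : A ⊕ A) (x : List A) :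
    (psiE c x).map σ = psiE (Sum.map σ σ c) (x.map σ) := by
  induction x with
  | nil => cases c <;> simp [psiE, psiL, psibarL]
  | cons b t ih =>
    cases c with
    | inl a =>
      simp only [psiE, psiL, Sum.map_inl, List.map_cons, List.flatten_cons, List.map_append] at ih ⊢
      rw [ih]
      by_cases h : b = a <;> simp [h]
    | inr a =>
      simp only [psiE, psibarL, Sum.map_inr, List.map_cons, List.flatten_cons,
        List.map_append] at ih ⊢
      rw [ih]
      by_cases h : b = a <;> simp [h]

theorem psiEW_cons {A : Type*} [DecidableEq A] (c : A ⊕ A) (v : List (A ⊕ A)) (x : List A) :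
    psiEW (c :: v) x = psiE c (psiEW v x) := rfl

theorem psiEW_append {A : Type*} [DecidableEq A] (u v : List (A ⊕ A)) (x : List A) :
    psiEW (u ++ v) x = psiEW u (psiEW v x) := by
  induction u with
  | nil => rfl
  | cons c u ih => rw [List.cons_append, psiEW_cons, psiEW_cons, ih]

theorem psiEW_map_perm {A : Type*} [DecidableEq A] (σ : Equiv.Perm A) (v : List (A ⊕ A))
    (x : List A) : (psiEW v x).map σ = psiEW (v.map (Sum.map σ σ)) (x.map σ) := by
  induction v with
  | nil => rfl
  | cons c v ih => rw [List.map_cons, psiEW_cons, psiEW_cons, psiE_map_perm, ih]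

theorem psiEW_iterate {A : Type*} [DecidableEq A] (π : Equiv.Perm A) (v : List (A ⊕ A)) (k : ℕ) :
    ∀ x : List A, (fun x : List A => psiEW v (x.map π))^[k] x =
      psiEW (((List.range k).map
        (fun j => v.map (Sum.map (⇑(π ^ j)) (⇑(π ^ j))))).flatten) (x.map (π ^ k : Equiv.Perm A)) := by
  induction k with
  | zero => intro x; simp [psiEW]
  | succ k ih =>
    intro x
    rw [Function.iterate_succ_apply, ih, psiEW_map_perm, List.range_succ, List.map_append,
      List.flatten_append, psiEW_append, List.map_map, pow_succ]
    simp [Equiv.Perm.coe_mul]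

theorem psiEW_iterate_orderOf {A : Type*} [DecidableEq A] (π : Equiv.Perm A) (v : List (A ⊕ A)) :
    (fun x : List A => psiEW v (x.map π))^[orderOf π] =
      psiEW (((List.range (orderOf π)).map
        (fun j => v.map (Sum.map (⇑(π ^ j)) (⇑(π ^ j))))).flatten) := by
  funext x
  rw [psiEW_iterate, pow_orderOf_eq_one]
  simp

/-- if π has order n then `(ψ_v ∘ π)ⁿ = ψ_{v·π(v)⋯πⁿ⁻¹(v)}`; in
particular every episturmian morphism has a power of the form ψ_w. -/
theorem pow_of_episturmian_is_psiW {A : Type*} [Fintype A] [DecidableEq A]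
    (π : Equiv.Perm A) (n : ℕ) (hn : orderOf π = n) (v : List (A ⊕ A)) :
    ((fun x : List A => psiEW v (x.map π))^[n] =
      psiEW (((List.range n).map
        (fun j => v.map (Sum.map (⇑(π ^ j)) (⇑(π ^ j))))).flatten)) ∧
    (∀ (v' : List (A ⊕ A)) (π' : Equiv.Perm A), ∃ m : ℕ, 1 ≤ m ∧
      ∃ w : List (A ⊕ A),
        (fun x : List A => psiEW v' (x.map π'))^[m] = psiEW w) := by
  subst hn
  exact ⟨psiEW_iterate_orderOf π v, fun v' π' =>
    ⟨orderOf π', orderOf_pos π', _, psiEW_iterate_orderOf π' v'⟩⟩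
end

section
/- Let A be a finite alphabet and d : ℕ → A a non-degenerate sequence. Let u ∈ L(d) and let r ≠ s be two distinct elements of the left return set R(u) of u in L(d). Set x = gcs(r·s, s·r), y = gcp(r·s, s·r), and w = x·y. Then: (i) w is a bispecial word of L(d); (ii) u occurs in w at index |x| and at no other index; and (iii) every bispecial word of L(d) that contains u as a factor has length at least |w|. -/
open List

section Helpers

variable {A : Type*}

/-! ### Palindromic closure -/

theorem palPlus_rev (x : List A) : (palPlus x).reverse = palPlus x :=
  (Classical.choose_spec (exists_isPalClosure x)).1.1

theorem palPlus_prefix (x : List A) : x <+: palPlus x :=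
  (Classical.choose_spec (exists_isPalClosure x)).1.2

theorem palPlus_min (x q : List A) (h1 : q.reverse = q) (h2 : x <+: q) :
    (palPlus x).length ≤ q.length :=
  (Classical.choose_spec (exists_isPalClosure x)).2 q h1 h2

theorem palPlus_len (z : List A) (b : A) :
    (palPlus (z ++ [b])).length ≤ 2 * z.length + 1 := by
  have h := palPlus_min (z ++ [b]) (z ++ [b] ++ z.reverse) (by simp) ⟨_, rfl⟩
  simp at h
  omega

theorem rev_getElem {Q : List A} (hQ : Q.reverse = Q) (i : ℕ) (hi : i < Q.length) :
    Q[i] = Q[Q.length - 1 - i]'(by omega) := by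
  have h : Q.reverse[i]'(by simpa using hi) = Q[i] := by simp only [hQ]
  rw [← h, List.getElem_reverse]

theorem pal_unique {Y P Q : List A} (hP : P.reverse = P) (hQ : Q.reverse = Q)
    (hYP : Y <+: P) (hYQ : Y <+: Q) (hl : P.length = Q.length)
    (h2 : Q.length ≤ 2 * Y.length) : P = Q := by
  apply List.ext_getElem hl
  intro i h1 h3
  by_cases hi : i < Y.length
  · rw [← hYP.getElem hi, ← hYQ.getElem hi]
  · rw [rev_getElem hP i h1, rev_getElem hQ i h3]
    have hi' : P.length - 1 - i < Y.length := by omega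
    rw [← hYP.getElem hi', ]
    have hi'' : Q.length - 1 - i < Y.length := by omega
    rw [← hYQ.getElem hi'']
    simp only [hl]

/-- No two consecutive letters different from `a`. -/
def NoAdj (a : A) (W : List A) : Prop := List.IsChain (fun x y => x = a ∨ y = a) W

theorem sep_pal {a : A} {Y Q : List A} (hY : NoAdj a Y) (hQ : Q.reverse = Q)
    (hYQ : Y <+: Q) (h2 : Q.length < 2 * Y.length) : NoAdj a Q := by
  unfold NoAdj at *
  rw [List.isChain_iff_getElem] at *
  intro i hi
  by_cases h : i + 1 < Y.length
  · have := hY i h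
    rwa [hYQ.getElem, hYQ.getElem] at this
  · have h3 := hY (Q.length - 2 - i) (by omega)
    rw [hYQ.getElem, hYQ.getElem] at h3
    rw [rev_getElem hQ i (by omega), rev_getElem hQ (i+1) (by omega)]
    have e1 : Q.length - 2 - i + 1 = Q.length - 1 - i := by omega
    have e2 : Q.length - 1 - (i + 1) = Q.length - 2 - i := by omega
    simp only [e1] at h3
    simp only [e2]
    exact h3.symm

variable [DecidableEq A]

/-! ### The morphism -/

theorem psiL_nil (a : A) : psiL a [] = [] := rfl

theorem psiL_cons (a b : A) (v : List A) :
    psiL a (b :: v) = (if b = a then [a] else [a, b]) ++ psiL a v := by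
  simp [psiL]

theorem psiL_append (a : A) (v w : List A) : psiL a (v ++ w) = psiL a v ++ psiL a w := by
  simp [psiL]

/-- `ψ_a(v) a`. -/
def E (a : A) (v : List A) : List A := psiL a v ++ [a]

theorem E_nil (a : A) : E a [] = [a] := rfl

theorem E_cons_self (a : A) (v : List A) : E a (a :: v) = a :: E a v := by
  simp [E, psiL_cons]

theorem E_cons_ne (a b : A) (h : b ≠ a) (v : List A) : E a (b :: v) = a :: b :: E a v := by
  simp [E, psiL_cons, h]

theorem E_append (a : A) (v w : List A) : E a (v ++ w) = psiL a v ++ E a w := by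
  simp [E, psiL_append]

theorem E_head (a : A) (v : List A) : ∃ z, E a v = a :: z := by
  cases v with
  | nil => exact ⟨[], rfl⟩
  | cons b v =>
    by_cases h : b = a
    · subst h; exact ⟨_, E_cons_self _ _⟩
    · exact ⟨_, E_cons_ne a b h v⟩

theorem E_last (a : A) (v : List A) : ∃ z, E a v = z ++ [a] := ⟨_, rfl⟩

/-- `ψ_a(bv)a` begins with `ab`. -/
theorem E_cons_two (a b : A) (v : List A) : ∃ z, E a (b :: v) = a :: b :: z := by
  by_cases h : b = a
  · subst h
    obtain ⟨z, hz⟩ := E_head b v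
    exact ⟨z, by rw [E_cons_self, hz]⟩
  · exact ⟨_, E_cons_ne a b h v⟩

theorem E_append_cons (a b : A) (v w : List A) : ∃ z, E a (v ++ b :: w) = E a v ++ b :: z := by
  obtain ⟨z, hz⟩ := E_cons_two a b w
  exact ⟨z, by rw [E_append, hz]; simp [E]⟩

/-- `ψ_a(bv)a` ends with `b ψ_a(v) a`. -/
theorem E_cons_suffix (a b : A) (v : List A) : b :: E a v <:+ E a (b :: v) := by
  by_cases h : b = a
  · subst h; rw [E_cons_self]
  · rw [E_cons_ne a b h]; exact ⟨[a], rfl⟩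

theorem E_sep (a : A) (v : List A) : NoAdj a (E a v) := by
  unfold NoAdj
  induction v with
  | nil => simp [E_nil]
  | cons b v ih =>
    by_cases h : b = a
    · subst h
      rw [E_cons_self]
      obtain ⟨z, hz⟩ := E_head b v
      rw [hz] at ih ⊢
      simp [ih]
    · rw [E_cons_ne a b h]
      obtain ⟨z, hz⟩ := E_head a v
      rw [hz] at ih ⊢
      simp [ih]

theorem E_inj (a : A) : ∀ v w : List A, E a v = E a w → v = w := by
  intro v
  induction v with
  | nil =>
    intro w h
    cases w with
    | nil => rfl
    | cons c w =>
      obtain ⟨z, hz⟩ := E_cons_two a c w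
      rw [hz, E_nil] at h
      simp at h
  | cons b v ih =>
    intro w h
    cases w with
    | nil =>
      obtain ⟨z, hz⟩ := E_cons_two a b v
      rw [hz, E_nil] at h
      simp at h
    | cons c w =>
      have hbc : b = c := by
        obtain ⟨z, hz⟩ := E_cons_two a b v
        obtain ⟨z', hz'⟩ := E_cons_two a c w
        rw [hz, hz'] at h
        simp at h
        exact h.1
      subst hbc
      by_cases hb : b = a
      · subst hb
        rw [E_cons_self, E_cons_self] at h
        simp at h
        rw [ih w h]
      · rw [E_cons_ne a b hb, E_cons_ne a b hb] at h
        simp at h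
        rw [ih w h]

theorem psiL_inj (a : A) (v w : List A) (h : psiL a v = psiL a w) : v = w :=
  E_inj a v w (by simp [E, h])

theorem E_reverse (a : A) (v : List A) : (E a v).reverse = E a v.reverse := by
  induction v with
  | nil => rfl
  | cons b v ih =>
    rw [List.reverse_cons, E_append]
    by_cases h : b = a
    · subst h
      rw [E_cons_self, List.reverse_cons, ih, E_cons_self, E_nil]
      simp [E]
    · rw [E_cons_ne a b h, List.reverse_cons, List.reverse_cons, ih, E_cons_ne a b h, E_nil]
      simp [E]

/-- Cutting before a letter `a` is always at a block boundary. -/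
theorem E_cut (a : A) : ∀ (P s z : List A), E a P = s ++ a :: z →
    ∃ P1 P2, P = P1 ++ P2 ∧ s = psiL a P1 ∧ a :: z = E a P2 := by
  intro P
  induction P with
  | nil =>
    intro s z h
    cases s with
    | nil => exact ⟨[], [], rfl, rfl, h.symm⟩
    | cons c s => rw [E_nil] at h; simp at h
  | cons b P ih =>
    intro s z h
    cases s with
    | nil => exact ⟨[], b :: P, rfl, rfl, h.symm⟩
    | cons c s =>
      by_cases hb : b = a
      · subst hb
        rw [E_cons_self] at h
        simp only [List.cons_append, List.cons.injEq] at h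
        obtain ⟨P1, P2, h1, h2, h3⟩ := ih s z h.2
        exact ⟨b :: P1, P2, by simp [h1], by simp [psiL_cons, h2, h.1], h3⟩
      · rw [E_cons_ne a b hb] at h
        simp only [List.cons_append, List.cons.injEq] at h
        cases s with
        | nil => simp at h; exact absurd h.2.1 hb
        | cons e s =>
          simp only [List.cons_append, List.cons.injEq] at h
          obtain ⟨P1, P2, h1, h2, h3⟩ := ih s z h.2.2
          exact ⟨b :: P1, P2, by simp [h1], by
            rw [psiL_cons, if_neg hb, h2, ← h.1, ← h.2.1]; rfl, h3⟩

/-- Occurrence of `ψ_a(v)a` in `ψ_a(P)a`. -/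
theorem E_occ (a : A) (P s v t : List A) (h : E a P = s ++ E a v ++ t) :
    ∃ P1 P2, P = P1 ++ v ++ P2 ∧ s = psiL a P1 ∧ a :: t = E a P2 := by
  obtain ⟨z, hz⟩ := E_head a v
  have h' : E a P = s ++ a :: (z ++ t) := by rw [h, hz]; simp
  obtain ⟨P1, P2, h1, h2, h3⟩ := E_cut a P s _ h'
  have h4 : E a P2 = psiL a v ++ a :: t := by
    rw [← h3, ← List.cons_append, ← hz]; simp [E]
  obtain ⟨P3, P4, h5, h6, h7⟩ := E_cut a P2 _ _ h4
  have := psiL_inj a _ _ h6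
  subst this
  exact ⟨P1, P4, by simp [h1, h5], h2, h7⟩

theorem E_infix (a : A) (v P : List A) : E a v <:+: E a P ↔ v <:+: P := by
  constructor
  · rintro ⟨s, t, h⟩
    obtain ⟨P1, P2, h1, -, -⟩ := E_occ a P s v t h.symm
    exact ⟨P1, P2, h1.symm⟩
  · rintro ⟨s, t, rfl⟩
    obtain ⟨z, hz⟩ := E_head a t
    rw [E_append, hz, psiL_append]
    exact ⟨psiL a s, z, by simp [E]⟩

/-- A factor of `ψ_a(P)a` which begins and ends with `a` is `ψ_a(v)a`. -/
theorem E_factor (a : A) (P u z z' : List A) (hu : u <:+: E a P) (h1 : u = a :: z)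
    (h2 : u = z' ++ [a]) : ∃ v, u = E a v := by
  obtain ⟨s, t, h⟩ := hu
  have h' : E a P = s ++ a :: (z ++ t) := by rw [← h, h1]; simp
  obtain ⟨P1, P2, -, -, h3⟩ := E_cut a P s _ h'
  have h4 : E a P2 = z' ++ a :: t := by
    rw [← h3, ← List.cons_append, ← h1, h2]; simp
  obtain ⟨P3, P4, -, h6, -⟩ := E_cut a P2 _ _ h4
  exact ⟨P3, by rw [h2, h6]; rfl⟩

theorem E_of_sep (a : A) : ∀ (n : ℕ) (W : List A), W.length ≤ n → NoAdj a W →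
    (∃ z, W = a :: z) → (∃ z, W = z ++ [a]) → ∃ q, W = E a q := by
  intro n
  induction n with
  | zero =>
    rintro W hn - ⟨z, rfl⟩ -
    simp at hn
  | succ n ih =>
    rintro W hn hs ⟨z, rfl⟩ ⟨z', hz'⟩
    cases z with
    | nil => exact ⟨[], rfl⟩
    | cons b z =>
      unfold NoAdj at hs
      rw [List.isChain_cons_cons] at hs
      cases z' with
      | nil => simp at hz'
      | cons e z' =>
      simp only [List.cons_append, List.cons.injEq] at hz'
      by_cases hb : b = a
      · subst hb
        obtain ⟨q, hq⟩ := ih (b :: z) (by simpa using hn) hs.2 ⟨_, rfl⟩ ⟨_, hz'.2⟩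
        exact ⟨b :: q, by rw [E_cons_self, hq]⟩
      · cases z' with
        | nil => simp at hz'; exact absurd hz'.2.1 hb
        | cons f z' =>
          simp only [List.cons_append, List.cons.injEq] at hz'
          cases z with
          | nil => simp at hz'
          | cons c z =>
            have hs2 := hs.2
            rw [List.isChain_cons_cons] at hs2
            have hc : c = a := by
              rcases hs2.1 with h | h
              · exact absurd h hb
              · exact h
            subst hc
            obtain ⟨q, hq⟩ := ih (c :: z) (by simp at hn ⊢; omega) hs2.2 ⟨_, rfl⟩ ⟨_, hz'.2.2⟩
            exact ⟨b :: q, by rw [E_cons_ne _ b hb, hq]⟩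

/-! ### Justin's formula -/

theorem palPlus_E (a b : A) (p : List A) :
    palPlus (E a p ++ [b]) = E a (palPlus (p ++ [b])) := by
  set m := palPlus (p ++ [b]) with hm
  set Q := palPlus (E a p ++ [b]) with hQ
  have hmrev : m.reverse = m := palPlus_rev _
  have hQrev : Q.reverse = Q := palPlus_rev _
  obtain ⟨g0, hg0⟩ : p ++ [b] <+: m := palPlus_prefix _
  have hQpre : E a p ++ [b] <+: Q := palPlus_prefix _
  have hmlen : m.length ≤ 2 * p.length + 1 := palPlus_len _ _
  have hQlen : Q.length ≤ 2 * (E a p).length + 1 := palPlus_len _ _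
  have hPrev : (E a m).reverse = E a m := by rw [E_reverse, hmrev]
  have hPpre : E a p ++ [b] <+: E a m := by
    obtain ⟨z, hz⟩ := E_append_cons a b p g0
    refine ⟨z, ?_⟩
    rw [← hg0, List.append_assoc, List.append_assoc]
    exact hz.symm
  have hQP : Q.length ≤ (E a m).length := palPlus_min _ _ hPrev hPpre
  -- Q is an E
  have hsepY : NoAdj a (E a p ++ [b]) := (E_sep a m).prefix hPpre
  have hsepQ : NoAdj a Q := sep_pal hsepY hQrev hQpre (by simp; omega)
  obtain ⟨t, ht⟩ := hQpre
  obtain ⟨zp, hzp⟩ := E_head a p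
  have hQh : Q = a :: (zp ++ [b] ++ t) := by rw [← ht, hzp]; simp
  have hQl : ∃ z, Q = z ++ [a] := by
    refine ⟨(zp ++ [b] ++ t).reverse, ?_⟩
    rw [← hQrev, hQh]; simp
  obtain ⟨q, hq⟩ := E_of_sep a Q.length Q le_rfl hsepQ ⟨_, hQh⟩ hQl
  have hqrev : q.reverse = q := by
    apply E_inj a
    rw [← E_reverse, ← hq, hQrev]
  have hqpre : ∃ g, q = p ++ [b] ++ g := by
    have h1 : E a q = [] ++ E a p ++ (b :: t) := by rw [← hq, ← ht]; simp
    obtain ⟨P1, P2, e1, e2, e3⟩ := E_occ a q [] p _ h1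
    have hP1 : P1 = [] := psiL_inj a _ _ e2.symm
    subst hP1
    cases P2 with
    | nil => rw [E_nil] at e3; simp at e3
    | cons c g =>
      obtain ⟨z, hz⟩ := E_cons_two a c g
      rw [hz] at e3
      simp at e3
      exact ⟨g, by rw [e1, e3.1]; simp⟩
  obtain ⟨g, hg⟩ := hqpre
  have hmq : m.length ≤ q.length := palPlus_min _ _ hqrev ⟨g, hg.symm⟩
  -- reversed tails
  have hlen0 : m.length = p.length + 1 + g0.length := by rw [← hg0]; simp; omega
  have hlen1 : q.length = p.length + 1 + g.length := by rw [hg]; simp; omega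
  have a1 : g0.reverse <+: p ++ [b] := by
    have k1 : g0.reverse <+: m := by
      rw [← hmrev, ← hg0, List.reverse_append]; exact ⟨_, rfl⟩
    exact List.prefix_of_prefix_length_le k1 ⟨g0, hg0⟩ (by simp; omega)
  have a2 : g0.reverse <+: q := a1.trans ⟨g, hg.symm⟩
  have a3 : g.reverse <+: q := by
    rw [← hqrev]
    rw [hg]
    rw [List.reverse_append]; exact ⟨_, rfl⟩
  have a4 : g0.reverse <+: g.reverse :=
    List.prefix_of_prefix_length_le a2 a3 (by simp; omega)
  have a5 : (E a g0).length ≤ (E a g).length := by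
    obtain ⟨k, hk⟩ := a4
    have l1 : (E a g0.reverse).length = (E a g0).length := by rw [← E_reverse]; simp
    have l2 : (E a g.reverse).length = (E a g).length := by rw [← E_reverse]; simp
    rw [← l1, ← l2, ← hk]
    simp [E, psiL_append]
  have hPQ : (E a m).length ≤ Q.length := by
    rw [hq, ← hg0, hg, E_append, E_append]
    simpa using a5
  refine pal_unique (Y := E a p ++ [b]) hQrev hPrev ⟨t, ht⟩ hPpre (le_antisymm hQP hPQ) ?_
  simp; omega

theorem pal_concat (v : List A) (b : A) : pal (v ++ [b]) = palPlus (pal v ++ [b]) := by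
  simp [pal]

theorem pal_cons (a : A) (v : List A) : pal (a :: v) = E a (pal v) := by
  induction v using List.reverseRecOn with
  | nil =>
    have h1 : pal [a] = palPlus ([] ++ [a]) := pal_concat [] a
    have h2 := palPlus_len [] a
    obtain ⟨t, ht⟩ := palPlus_prefix ([] ++ [a])
    rw [← ht] at h2
    have h3 : t = [] := by
      have : t.length = 0 := by simpa using h2
      simpa using this
    rw [h1, ← ht, h3]
    rfl
  | append_singleton v b ih =>
    rw [← List.cons_append, pal_concat, ih, palPlus_E, pal_concat]

theorem pal_range_succ (d : ℕ → A) (n : ℕ) :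
    pal ((List.range (n+1)).map d) = E (d 0) (pal ((List.range n).map (fun i => d (i+1)))) := by
  rw [List.range_succ_eq_map, List.map_cons, pal_cons, List.map_map]
  rfl

/-! ### The language -/

theorem lang_infix {d : ℕ → A} {u v : List A} (h : u <:+: v) (hv : v ∈ LangD d) : u ∈ LangD d := by
  obtain ⟨n, hn⟩ := hv
  exact ⟨n, h.trans hn⟩

theorem lang_E {d : ℕ → A} {u : List A} (hu : u ∈ LangD d) :
    ∃ P, u <:+: E (d 0) P ∧ P ∈ LangD (fun i => d (i+1)) := by
  obtain ⟨n, hn⟩ := hu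
  cases n with
  | zero =>
    have : u = [] := by simpa [pal] using hn
    subst this
    exact ⟨[], List.nil_infix, 0, List.nil_infix⟩
  | succ n =>
    rw [pal_range_succ] at hn
    exact ⟨_, hn, n, List.infix_refl _⟩

theorem E_mem {d : ℕ → A} {v : List A} :
    E (d 0) v ∈ LangD d ↔ v ∈ LangD (fun i => d (i+1)) := by
  constructor
  · intro h
    obtain ⟨P, h1, h2⟩ := lang_E h
    exact lang_infix ((E_infix _ _ _).1 h1) h2
  · rintro ⟨n, hn⟩
    refine ⟨n+1, ?_⟩
    rw [pal_range_succ]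
    exact (E_infix _ _ _).2 hn

theorem lang_sep {d : ℕ → A} {u : List A} (hu : u ∈ LangD d) : NoAdj (d 0) u := by
  obtain ⟨P, h1, -⟩ := lang_E hu
  exact (E_sep _ _).infix h1

theorem sep_left {a b : A} {s z : List A} {W : List A} (hW : NoAdj a W) (hh : ∃ w, W = a :: w)
    (hb : b ≠ a) (h : W = s ++ b :: z) : ∃ s0, s = s0 ++ [a] := by
  induction s using List.reverseRecOn with
  | nil =>
    obtain ⟨w, hw⟩ := hh
    rw [hw] at h
    simp at h
    exact absurd h.1.symm hb
  | append_singleton s c ih =>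
    have h1 : [c, b] <:+: W := ⟨s, z, by rw [h]; simp⟩
    have h2 := List.IsChain.infix hW h1
    simp [hb] at h2
    exact ⟨s, by rw [h2]⟩

theorem sep_right {a b : A} {s z : List A} {W : List A} (hW : NoAdj a W) (hh : ∃ w, W = w ++ [a])
    (hb : b ≠ a) (h : W = s ++ b :: z) : ∃ z0, z = a :: z0 := by
  cases z with
  | nil =>
    obtain ⟨w, hw⟩ := hh
    rw [hw] at h
    have := List.append_inj_right' h rfl
    simp at this
    exact absurd this.symm hb
  | cons c z =>
    have h1 : [b, c] <:+: W := ⟨s, z, by rw [h]; simp⟩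
    have h2 := List.IsChain.infix hW h1
    simp [hb] at h2
    exact ⟨z, by rw [h2]⟩

/-- Left extension of a factor of `ψ_a(P)a`. -/
theorem ext_left {a b : A} {u P : List A} (hb : b ≠ a) (h : b :: u <:+: E a P) :
    a :: b :: u <:+: E a P := by
  obtain ⟨s, t, h⟩ := h
  obtain ⟨s0, rfl⟩ := sep_left (E_sep a P) (E_head a P) hb (s := s) (z := u ++ t)
    (by rw [← h]; simp)
  exact ⟨s0, t, by rw [← h]; simp⟩

theorem ext_right {a b : A} {u P : List A} (hb : b ≠ a) (h : u ++ [b] <:+: E a P) :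
    u ++ [b] ++ [a] <:+: E a P := by
  obtain ⟨s, t, h⟩ := h
  obtain ⟨s0, rfl⟩ := sep_right (E_sep a P) (E_last a P) hb (s := s ++ u) (z := t)
    (by rw [← h]; simp)
  exact ⟨s, s0, by rw [← h]; simp⟩

theorem mem_ext_left {d : ℕ → A} {b : A} {u : List A} (hb : b ≠ d 0) (h : b :: u ∈ LangD d) :
    d 0 :: b :: u ∈ LangD d := by
  obtain ⟨P, h1, h2⟩ := lang_E h
  exact lang_infix (ext_left hb h1) (E_mem.2 h2)

theorem mem_ext_right {d : ℕ → A} {b : A} {u : List A} (hb : b ≠ d 0) (h : u ++ [b] ∈ LangD d) :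
    u ++ [b] ++ [d 0] ∈ LangD d := by
  obtain ⟨P, h1, h2⟩ := lang_E h
  exact lang_infix (ext_right hb h1) (E_mem.2 h2)

theorem mem_factor {d : ℕ → A} {u z z' : List A} (hu : u ∈ LangD d) (h1 : u = d 0 :: z)
    (h2 : u = z' ++ [d 0]) : ∃ v, u = E (d 0) v := by
  obtain ⟨P, h3, -⟩ := lang_E hu
  exact E_factor _ P u z z' h3 h1 h2

theorem cons_E_mem {d : ℕ → A} {c : A} {v : List A} :
    c :: E (d 0) v ∈ LangD d ↔ c :: v ∈ LangD (fun i => d (i+1)) := by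
  rw [← E_mem]
  by_cases hc : c = d 0
  · rw [hc, E_cons_self]
  · rw [E_cons_ne _ c hc]
    exact ⟨mem_ext_left hc, lang_infix ⟨[d 0], [], by simp⟩⟩

theorem E_snoc_mem {d : ℕ → A} {c : A} {v : List A} :
    E (d 0) v ++ [c] ∈ LangD d ↔ v ++ [c] ∈ LangD (fun i => d (i+1)) := by
  rw [← E_mem, E_append]
  by_cases hc : c = d 0
  · rw [hc, E_cons_self, E_nil]; simp [E]
  · rw [E_cons_ne _ c hc, E_nil]
    have e : psiL (d 0) v ++ [d 0, c, d 0] = E (d 0) v ++ [c] ++ [d 0] := by simp [E]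
    rw [e]
    exact ⟨mem_ext_right hc, lang_infix ⟨[], [d 0], by simp⟩⟩

theorem leftSpecial_E {d : ℕ → A} {v : List A} :
    LeftSpecial (LangD d) (E (d 0) v) ↔ LeftSpecial (LangD (fun i => d (i+1))) v := by
  simp only [LeftSpecial, cons_E_mem]

theorem rightSpecial_E {d : ℕ → A} {v : List A} :
    RightSpecial (LangD d) (E (d 0) v) ↔ RightSpecial (LangD (fun i => d (i+1))) v := by
  simp only [RightSpecial, E_snoc_mem]

/-- Nonempty bispecial words desubstitute. -/
theorem bispecial_E {d : ℕ → A} {b : List A} (hb : b ≠ []) (h1 : LeftSpecial (LangD d) b)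
    (h2 : RightSpecial (LangD d) b) : ∃ v, b = E (d 0) v := by
  have hh : ∃ z, b = d 0 :: z := by
    cases b with
    | nil => exact absurd rfl hb
    | cons f b =>
      obtain ⟨c, e, hce, hc, he⟩ := h1
      have k1 := lang_sep hc
      have k2 := lang_sep he
      unfold NoAdj at k1 k2
      rw [List.isChain_cons_cons] at k1 k2
      refine ⟨b, ?_⟩
      rcases k1.1 with k | k
      · rcases k2.1 with k' | k'
        · exact absurd (k.trans k'.symm) hce
        · rw [k']
      · rw [k]
  have hl : ∃ z, b = z ++ [d 0] := by
    induction b using List.reverseRecOn with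
    | nil => exact absurd rfl hb
    | append_singleton b f _ =>
      obtain ⟨c, e, hce, hc, he⟩ := h2
      have k1 := List.IsChain.infix (lang_sep hc) (show [f, c] <:+: _ from ⟨b, [], by simp⟩)
      have k2 := List.IsChain.infix (lang_sep he) (show [f, e] <:+: _ from ⟨b, [], by simp⟩)
      simp at k1 k2
      refine ⟨b, ?_⟩
      rcases k1 with k | k
      · rw [k]
      · rcases k2 with k' | k'
        · rw [k']
        · exact absurd (k.trans k'.symm) hce
  obtain ⟨z, hz⟩ := hh
  obtain ⟨z', hz'⟩ := hl
  obtain ⟨c, e, -, hc, -⟩ := h1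
  exact mem_factor (lang_infix ⟨[c], [], by simp⟩ hc) hz hz'

/-! ### gcp and gcs -/

theorem gcp_of (Z X Y : List A) (b c : A) (h : b ≠ c) :
    gcp (Z ++ b :: X) (Z ++ c :: Y) = Z := by
  induction Z with
  | nil => simp [gcp, h]
  | cons e Z ih => simp [gcp, ih]

theorem exists_diff : ∀ X Y : List A, X.length = Y.length → X ≠ Y →
    ∃ Z b c X1 Y1, b ≠ c ∧ X = Z ++ b :: X1 ∧ Y = Z ++ c :: Y1 := by
  intro X
  induction X with
  | nil =>
    intro Y h hne
    exact absurd (List.length_eq_zero_iff.1 h.symm).symm hne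
  | cons b X ih =>
    intro Y h hne
    cases Y with
    | nil => simp at h
    | cons c Y =>
      by_cases hbc : b = c
      · subst hbc
        obtain ⟨Z, e, f, X1, Y1, h1, h2, h3⟩ := ih Y (by simpa using h) (by simpa using hne)
        exact ⟨b :: Z, e, f, X1, Y1, h1, by simp [h2], by simp [h3]⟩
      · exact ⟨[], b, c, X, Y, hbc, rfl, rfl⟩

theorem gcs_of (Z X Y : List A) (b c : A) (h : b ≠ c) :
    gcs (X ++ b :: Z) (Y ++ c :: Z) = Z := by
  have := gcp_of Z.reverse X.reverse Y.reverse b c h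
  simp [gcs, this]

theorem exists_diff_suffix (X Y : List A) (hl : X.length = Y.length) (hne : X ≠ Y) :
    ∃ Z b c X1 Y1, b ≠ c ∧ X = X1 ++ b :: Z ∧ Y = Y1 ++ c :: Z := by
  obtain ⟨Z, b, c, X1, Y1, h1, h2, h3⟩ := exists_diff X.reverse Y.reverse (by simpa using hl)
    (by simpa using hne)
  refine ⟨Z.reverse, b, c, X1.reverse, Y1.reverse, h1, ?_, ?_⟩
  · rw [← List.reverse_reverse X, h2]; simp
  · rw [← List.reverse_reverse Y, h3]; simp

theorem gcp_append_right (X Y U V : List A) (hl : X.length = Y.length) (hne : X ≠ Y) :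
    gcp (X ++ U) (Y ++ V) = gcp X Y := by
  obtain ⟨Z, b, c, X1, Y1, h, rfl, rfl⟩ := exists_diff X Y hl hne
  rw [gcp_of Z _ _ b c h]
  simp only [List.append_assoc, List.cons_append]
  rw [gcp_of Z _ _ b c h]

theorem gcs_append_left (X Y U V : List A) (hl : X.length = Y.length) (hne : X ≠ Y) :
    gcs (U ++ X) (V ++ Y) = gcs X Y := by
  obtain ⟨Z, b, c, X1, Y1, h, rfl, rfl⟩ := exists_diff_suffix X Y hl hne
  rw [gcs_of Z _ _ b c h, ← List.append_assoc, ← List.append_assoc, gcs_of Z _ _ b c h]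

theorem gcs_snoc (X Y : List A) (a : A) : gcs (X ++ [a]) (Y ++ [a]) = gcs X Y ++ [a] := by
  simp [gcs, gcp]

theorem gcp_E (a : A) (X Y : List A) (hl : X.length = Y.length) (hne : X ≠ Y) :
    gcp (E a X) (E a Y) = E a (gcp X Y) := by
  obtain ⟨Z, b, c, X1, Y1, h, rfl, rfl⟩ := exists_diff X Y hl hne
  rw [gcp_of Z _ _ b c h]
  obtain ⟨z1, h1⟩ := E_append_cons a b Z X1
  obtain ⟨z2, h2⟩ := E_append_cons a c Z Y1
  rw [h1, h2, gcp_of _ _ _ b c h]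

theorem gcs_psi (a : A) (X Y : List A) (hl : X.length = Y.length) (hne : X ≠ Y) :
    gcs (psiL a X) (psiL a Y) = psiL a (gcs X Y) := by
  obtain ⟨Z, b, c, X1, Y1, h, rfl, rfl⟩ := exists_diff_suffix X Y hl hne
  rw [gcs_of Z _ _ b c h]
  have key : ∀ (W : List A) (e : A), ∃ W', psiL a (W ++ e :: Z) = W' ++ e :: psiL a Z := by
    intro W e
    by_cases he : e = a
    · exact ⟨psiL a W, by simp [psiL_append, psiL_cons, he]⟩
    · exact ⟨psiL a W ++ [a], by simp [psiL_append, psiL_cons, he]⟩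
  obtain ⟨z1, h1⟩ := key X1 b
  obtain ⟨z2, h2⟩ := key Y1 c
  rw [h1, h2, gcs_of _ _ _ b c h]

/-! ### The induction -/

/-- The strengthened conclusion. -/
def Concl (L : Set (List A)) (u r s : List A) : Prop :=
  r ++ s ≠ s ++ r ∧ ∃ x y : List A, x = gcs (r ++ s) (s ++ r) ∧ y = gcp (r ++ s) (s ++ r) ∧
    (x ++ y ∈ L ∧ LeftSpecial L (x ++ y) ∧ RightSpecial L (x ++ y)) ∧
    ((∃ t : List A, x ++ y = x ++ u ++ t) ∧
      (∀ p q : List A, x ++ y = p ++ u ++ q → p = x)) ∧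
    (∀ b : List A, LeftSpecial L b → RightSpecial L b → u <:+: b → x ++ y <:+: b)

theorem concl_nil (d : ℕ → A) (r s : List A) (hr : r ∈ leftReturn (LangD d) [])
    (hs : s ∈ leftReturn (LangD d) []) (hrs : r ≠ s) : Concl (LangD d) [] r s := by
  have key : ∀ r ∈ leftReturn (LangD d) ([] : List A), ∃ a, r = [a] ∧ [a] ∈ LangD d := by
    rintro r ⟨h1, ⟨s, h2, h3⟩, h4⟩
    simp at h3 h1
    subst h3
    cases r with
    | nil => exact absurd rfl h2
    | cons a r =>
      cases r with
      | nil => exact ⟨a, rfl, h1⟩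
      | cons b r => exact absurd ⟨[a], b :: r, by simp, by simp, by simp⟩ h4
  obtain ⟨a, rfl, ha⟩ := key r hr
  obtain ⟨b, rfl, hb⟩ := key s hs
  have hab : a ≠ b := fun h => hrs (by rw [h])
  refine ⟨by simp [hab], [], [], ?_, ?_, ⟨?_, ?_, ?_⟩, ⟨⟨[], rfl⟩, ?_⟩, ?_⟩
  · simp [gcs, gcp, hab.symm]
  · simp [gcp, hab]
  · exact lang_infix List.nil_infix ha
  · exact ⟨a, b, hab, ha, hb⟩
  · exact ⟨a, b, hab, ha, hb⟩
  · intro p q h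
    simp at h
    exact h.1
  · intro b _ _ _
    exact List.nil_infix

theorem return_E {d : ℕ → A} {u r : List A} (hr : r ∈ leftReturn (LangD d) (E (d 0) u)) :
    ∃ r', r = psiL (d 0) r' ∧ r' ∈ leftReturn (LangD (fun i => d (i+1))) u := by
  obtain ⟨h1, ⟨s, hs, h2⟩, h3⟩ := hr
  obtain ⟨z, hz⟩ := E_head (d 0) u
  obtain ⟨v, hv⟩ := mem_factor h1 (z := z ++ s) (z' := r ++ psiL (d 0) u)
    (by rw [h2, hz]; simp) (by simp [E])
  obtain ⟨P1, P2, e1, e2, e3⟩ := E_occ (d 0) v r u [] (by rw [← hv]; simp)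
  have hP2 : P2 = [] := E_inj (d 0) _ _ (by rw [← e3, E_nil])
  subst hP2
  rw [List.append_nil] at e1
  refine ⟨P1, e2, ?_, ?_, ?_⟩
  · rw [← e1, ← E_mem, ← hv]; exact h1
  · obtain ⟨Q1, Q2, f1, f2, f3⟩ := E_occ (d 0) v [] u s (by rw [← hv, h2]; simp)
    have hQ1 : Q1 = [] := psiL_inj (d 0) _ _ f2.symm
    subst hQ1
    refine ⟨Q2, ?_, by rw [← e1, f1]; simp⟩
    rintro rfl
    rw [E_nil] at f3
    simp at f3
    exact hs f3
  · rintro ⟨p, q, hp, hq, hpq⟩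
    apply h3
    obtain ⟨c, q, rfl⟩ := List.exists_cons_of_ne_nil hq
    obtain ⟨z, hz⟩ := E_append_cons (d 0) c u q
    refine ⟨psiL (d 0) p, c :: z, ?_, by simp, ?_⟩
    · intro h
      exact hp (psiL_inj (d 0) _ _ h)
    · rw [hv, e1, hpq, List.append_assoc, E_append, hz]
      simp

theorem concl_E {d : ℕ → A} {u r s : List A} (h : Concl (LangD (fun i => d (i+1))) u r s) :
    Concl (LangD d) (E (d 0) u) (psiL (d 0) r) (psiL (d 0) s) := by
  obtain ⟨hne, x, y, hx, hy, ⟨b1, b2, b3⟩, ⟨⟨t, ht⟩, huniq⟩, hmin⟩ := h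
  have hne' : psiL (d 0) r ++ psiL (d 0) s ≠ psiL (d 0) s ++ psiL (d 0) r := by
    rw [← psiL_append, ← psiL_append]
    intro h
    exact hne (psiL_inj _ _ _ h)
  have hw : psiL (d 0) x ++ E (d 0) y = E (d 0) (x ++ y) := (E_append _ _ _).symm
  refine ⟨hne', psiL (d 0) x, E (d 0) y, ?_, ?_, ?_, ⟨?_, ?_⟩, ?_⟩
  · rw [← psiL_append, ← psiL_append, gcs_psi _ _ _ (by simp; omega) hne, hx]
  · rw [← gcp_append_right _ _ [d 0] [d 0] (by simp; omega) hne', ← psiL_append, ← psiL_append]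
    change _ = gcp (E (d 0) _) (E (d 0) _)
    rw [gcp_E _ _ _ (by simp; omega) hne, hy]
  · rw [hw]
    exact ⟨E_mem.2 b1, leftSpecial_E.2 b2, rightSpecial_E.2 b3⟩
  · rw [hw, ht]
    obtain ⟨z, hz⟩ := E_head (d 0) t
    refine ⟨z, ?_⟩
    rw [List.append_assoc, E_append, E_append, hz]
    simp [E]
  · intro p q hpq
    rw [hw] at hpq
    obtain ⟨P1, P2, e1, e2, -⟩ := E_occ _ _ _ _ _ hpq
    rw [e2, huniq _ _ e1]
  · intro b hl hr hub
    have hb : b ≠ [] := by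
      rintro rfl
      simp [E] at hub
    obtain ⟨v, rfl⟩ := bispecial_E hb hl hr
    rw [hw, E_infix]
    exact hmin v (leftSpecial_E.1 hl) (rightSpecial_E.1 hr) ((E_infix _ _ _).1 hub)

/-- Right extension. -/
theorem return_right {d : ℕ → A} {u r : List A} {b : A} (hb : b ≠ d 0)
    (hr : r ∈ leftReturn (LangD d) (u ++ [b])) :
    r ∈ leftReturn (LangD d) (u ++ [b] ++ [d 0]) := by
  obtain ⟨h1, ⟨s, hs, h2⟩, h3⟩ := hr
  have h4 : r ++ (u ++ [b] ++ [d 0]) ∈ LangD d := by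
    have := mem_ext_right (u := r ++ u) hb (by simpa using h1)
    simpa using this
  refine ⟨h4, ?_, ?_⟩
  · obtain ⟨s0, hs0⟩ := sep_right (z := s ++ [d 0]) (s := u) (lang_sep h4)
      ⟨r ++ (u ++ [b]), by simp⟩ hb (by
        rw [← List.append_assoc r, h2]; simp)
    cases s with
    | nil => exact absurd rfl hs
    | cons c s =>
      simp at hs0
      refine ⟨s ++ [d 0], by simp, ?_⟩
      rw [← List.append_assoc r, h2, hs0.1]; simp
  · rintro ⟨p, q, hp, hq, hpq⟩
    obtain ⟨q0, c, rfl⟩ := (List.eq_nil_or_concat q).resolve_left hq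
    apply h3
    refine ⟨p, d 0 :: q0, hp, by simp, ?_⟩
    have : (r ++ (u ++ [b])) ++ [d 0] = (p ++ (u ++ [b]) ++ d 0 :: q0) ++ [c] := by
      simpa using hpq
    exact List.append_inj_left' this rfl

theorem concl_right {d : ℕ → A} {u r s : List A} {b : A} (hb : b ≠ d 0)
    (h : Concl (LangD d) (u ++ [b] ++ [d 0]) r s) : Concl (LangD d) (u ++ [b]) r s := by
  obtain ⟨hne, x, y, hx, hy, ⟨b1, b2, b3⟩, ⟨⟨t, ht⟩, huniq⟩, hmin⟩ := h
  have hwE : ∃ v, x ++ y = E (d 0) v := bispecial_E (by rw [ht]; simp) b2 b3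
  refine ⟨hne, x, y, hx, hy, ⟨b1, b2, b3⟩, ⟨⟨d 0 :: t, by rw [ht]; simp⟩, ?_⟩, ?_⟩
  · intro p q hpq
    obtain ⟨v, hv⟩ := hwE
    obtain ⟨q0, rfl⟩ := sep_right (s := p ++ u) (z := q) (E_sep (d 0) v) (E_last _ _) hb
      (by rw [← hv, hpq]; simp)
    exact huniq p q0 (by rw [hpq]; simp)
  · intro w hl hr hub
    have hw : w ≠ [] := by
      rintro rfl
      simp at hub
    obtain ⟨v, rfl⟩ := bispecial_E hw hl hr
    exact hmin _ hl hr (ext_right hb hub)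

/-- Left extension. -/
theorem return_left {d : ℕ → A} {u r : List A} {b : A} (hb : b ≠ d 0)
    (hr : r ∈ leftReturn (LangD d) (b :: u)) :
    ∃ r0, r = r0 ++ [d 0] ∧ d 0 :: r0 ∈ leftReturn (LangD d) (d 0 :: b :: u) := by
  obtain ⟨h1, ⟨s, hs, h2⟩, h3⟩ := hr
  have h4 : d 0 :: (r ++ b :: u) ∈ LangD d := by
    rw [h2] at h1 ⊢
    exact mem_ext_left hb h1
  obtain ⟨s0, hs0⟩ := sep_left (s := d 0 :: r) (z := u) (lang_sep h4) ⟨_, rfl⟩ hb (by simp)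
  have hrne : r ≠ [] := by
    rintro rfl
    have := congrArg List.length h2
    simp at this
    exact hs (by simpa using this)
  cases s0 with
  | nil => simp at hs0; exact absurd hs0 hrne
  | cons c r0 =>
    simp at hs0
    have hr0 := hs0.2
    subst hr0
    refine ⟨r0, rfl, by simpa using h4, ⟨s, hs, ?_⟩, ?_⟩
    · simp only [List.cons_append, List.cons.injEq, true_and]
      simpa using h2
    · rintro ⟨p, q, hp, hq, hpq⟩
      obtain ⟨e, p, rfl⟩ := List.exists_cons_of_ne_nil hp
      simp only [List.cons_append, List.cons.injEq] at hpq
      exact h3 ⟨p ++ [d 0], q, by simp, hq, by simpa using hpq.2⟩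

theorem concl_left {d : ℕ → A} {u r s : List A} {b : A} (hb : b ≠ d 0)
    (h : Concl (LangD d) (d 0 :: b :: u) (d 0 :: r) (d 0 :: s)) :
    Concl (LangD d) (b :: u) (r ++ [d 0]) (s ++ [d 0]) := by
  obtain ⟨hne, x, y, hx, hy, ⟨b1, b2, b3⟩, ⟨⟨t, ht⟩, huniq⟩, hmin⟩ := h
  have hne' : r ++ [d 0] ++ (s ++ [d 0]) ≠ s ++ [d 0] ++ (r ++ [d 0]) := by
    intro h
    apply hne
    have h' : (r ++ d 0 :: s) ++ [d 0] = (s ++ d 0 :: r) ++ [d 0] := by simpa using h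
    simpa using List.append_inj_left' h' rfl
  have hy' : y = d 0 :: gcp (r ++ [d 0] ++ (s ++ [d 0])) (s ++ [d 0] ++ (r ++ [d 0])) := by
    rw [hy, ← gcp_append_right _ _ [d 0] [d 0] (by simp; omega) hne]
    simp [gcp]
  have hx' : x ++ [d 0] = gcs (r ++ [d 0] ++ (s ++ [d 0])) (s ++ [d 0] ++ (r ++ [d 0])) := by
    rw [hx, ← gcs_snoc, ← gcs_append_left _ _ [d 0] [d 0] (by simp; omega) hne']
    simp
  have hwE : ∃ v, x ++ y = E (d 0) v := bispecial_E (by rw [ht]; simp) b2 b3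
  set y' := gcp (r ++ [d 0] ++ (s ++ [d 0])) (s ++ [d 0] ++ (r ++ [d 0])) with hyd
  have hw : x ++ [d 0] ++ y' = x ++ y := by rw [hy']; simp
  refine ⟨hne', x ++ [d 0], y', hx', rfl, ?_, ⟨?_, ?_⟩, ?_⟩
  · rw [hw]; exact ⟨b1, b2, b3⟩
  · rw [hw]; exact ⟨t, by rw [ht]; simp⟩
  · intro p q hpq
    rw [hw] at hpq
    obtain ⟨v, hv⟩ := hwE
    obtain ⟨p0, rfl⟩ := sep_left (s := p) (z := u ++ q) (E_sep (d 0) v) (E_head _ _) hb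
      (by rw [← hv, hpq]; simp)
    rw [huniq p0 q (by rw [hpq]; simp)]
  · intro w hl hr hub
    have hwn : w ≠ [] := by
      rintro rfl
      simp at hub
    obtain ⟨v, rfl⟩ := bispecial_E hwn hl hr
    rw [hw]
    exact hmin _ hl hr (ext_left hb hub)

theorem concl_all : ∀ (n : ℕ) (d : ℕ → A) (u r s : List A), u <:+: pal ((List.range n).map d) →
    r ∈ leftReturn (LangD d) u → s ∈ leftReturn (LangD d) u → r ≠ s →
    Concl (LangD d) u r s := by
  intro n
  induction n with
  | zero =>
    intro d u r s hu hr hs hrs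
    have : u = [] := by simpa [pal] using hu
    subst this
    exact concl_nil d r s hr hs hrs
  | succ n ih =>
    -- case: begins and ends with `a`
    have stepE : ∀ (d : ℕ → A) (u r s : List A), u <:+: pal ((List.range (n+1)).map d) →
        (∃ z, u = d 0 :: z) → (∃ z, u = z ++ [d 0]) →
        r ∈ leftReturn (LangD d) u → s ∈ leftReturn (LangD d) u → r ≠ s →
        Concl (LangD d) u r s := by
      rintro d u r s hu ⟨z, hz⟩ ⟨z', hz'⟩ hr hs hrs
      rw [pal_range_succ] at hu
      obtain ⟨v, rfl⟩ := E_factor _ _ u z z' hu hz hz'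
      obtain ⟨r', rfl, hr'⟩ := return_E hr
      obtain ⟨s', rfl, hs'⟩ := return_E hs
      exact concl_E (ih _ v r' s' ((E_infix _ _ _).1 hu) hr' hs' (fun h => hrs (by rw [h])))
    -- case: begins with `a`
    have stepR : ∀ (d : ℕ → A) (u r s : List A), u <:+: pal ((List.range (n+1)).map d) →
        (∃ z, u = d 0 :: z) →
        r ∈ leftReturn (LangD d) u → s ∈ leftReturn (LangD d) u → r ≠ s →
        Concl (LangD d) u r s := by
      rintro d u r s hu ⟨z, hz⟩ hr hs hrs
      rcases List.eq_nil_or_concat u with rfl | ⟨u0, b, rfl⟩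
      · simp at hz
      · rw [List.concat_eq_append] at *
        by_cases hb : b = d 0
        · exact stepE d _ r s hu ⟨z, hz⟩ ⟨u0, by rw [hb]⟩ hr hs hrs
        · refine concl_right hb (stepE d (u0 ++ [b] ++ [d 0]) r s ?_ ⟨z ++ [d 0], by rw [hz]; simp⟩ ⟨_, rfl⟩
            (return_right hb hr) (return_right hb hs) hrs)
          rw [pal_range_succ] at hu ⊢
          exact ext_right hb hu
    intro d u r s hu hr hs hrs
    cases u with
    | nil => exact concl_nil d r s hr hs hrs
    | cons b u =>
      by_cases hb : b = d 0
      · exact stepR d _ r s hu ⟨u, by rw [hb]⟩ hr hs hrs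
      · obtain ⟨r0, rfl, hr0⟩ := return_left hb hr
        obtain ⟨s0, rfl, hs0⟩ := return_left hb hs
        refine concl_left hb (stepR d _ _ _ ?_ ⟨_, rfl⟩ hr0 hs0 ?_)
        · rw [pal_range_succ] at hu ⊢
          exact ext_left hb hu
        · intro h
          simp at h
          exact hrs (by rw [h])

end Helpers

/-- for distinct left return words r ≠ s of u, the word
`w = gcs(rs,sr)·gcp(rs,sr)` is bispecial, u occurs in w exactly at index |gcs(rs,sr)|,
and w is the shortest bispecial word containing u. -/
theorem gcs_append_gcp_is_shortest_bispecial {A : Type*} [Fintype A] [DecidableEq A]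
    (d : ℕ → A) (hd : NonDegenerate d)
    (u : List A) (hu : u ∈ LangD d)
    (r s : List A) (hr : r ∈ leftReturn (LangD d) u) (hs : s ∈ leftReturn (LangD d) u)
    (hrs : r ≠ s)
    (x y : List A) (hx : x = gcs (r ++ s) (s ++ r)) (hy : y = gcp (r ++ s) (s ++ r)) :
    (x ++ y ∈ LangD d ∧ LeftSpecial (LangD d) (x ++ y) ∧ RightSpecial (LangD d) (x ++ y)) ∧
    ((∃ t : List A, x ++ y = x ++ u ++ t) ∧
      (∀ p q : List A, x ++ y = p ++ u ++ q → p = x)) ∧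
    (∀ b : List A, LeftSpecial (LangD d) b → RightSpecial (LangD d) b →
      u <:+: b → (x ++ y).length ≤ b.length) := by
  obtain ⟨n, hn⟩ := hu
  obtain ⟨-, x', y', hx', hy', h1, h2, h3⟩ := concl_all n d u r s hn hr hs hrs
  have ex : x = x' := hx.trans hx'.symm
  have ey : y = y' := hy.trans hy'.symm
  subst ex ey
  exact ⟨h1, h2, fun b hl hr hub => (h3 b hl hr hub).length_le⟩
end
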